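/- Let X be a GC_5 set of 21 nodes with no maximal line, and suppose a line ℓ̃ is used by three distinct nodes A, B, C ∈ X. Then ℓ̃ passes through at least three nodes of X. If, moreover, ℓ̃ is a 4-node line, then A, B, C share ℓ̃ and three other lines, and ℓ̃ is used only by A, B, C, i.e., it is used by exactly three nodes of X. -/

import Mathlib

open MvPolynomial

/-- Evaluation of a bivariate polynomial at a point of the real plane. -/
noncomputable def ev (p : MvPolynomial (Fin 2) ℝ) (A : ℝ × ℝ) : ℝ :=
  MvPolynomial.eval ![A.1, A.2] p

/-- A polynomial of total degree exactly 1, defining a line. -/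
def IsLinePoly (l : MvPolynomial (Fin 2) ℝ) : Prop := l.totalDegree = 1

/-- The line (zero set) defined by a polynomial. -/
def lineSet (l : MvPolynomial (Fin 2) ℝ) : Set (ℝ × ℝ) := {A | ev l A = 0}

/-- The number of nodes of `X` lying on the line defined by `l`. -/
noncomputable def nodesOn (X : Set (ℝ × ℝ)) (l : MvPolynomial (Fin 2) ℝ) : ℕ :=
  (X ∩ lineSet l).ncard

/-- `X` is an `n`-poised set: it has `N = (n+2)(n+1)/2` nodes and the only polynomial of
degree ≤ n vanishing on all of `X` is the zero polynomial. -/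
def Poised (n : ℕ) (X : Set (ℝ × ℝ)) : Prop :=
  X.Finite ∧ X.ncard = (n + 2) * (n + 1) / 2 ∧
    ∀ p : MvPolynomial (Fin 2) ℝ, p.totalDegree ≤ n → (∀ A ∈ X, ev p A = 0) → p = 0

/-- `p` is an `n`-fundamental polynomial of the node `A` with respect to `X`. -/
def IsFund (n : ℕ) (X : Set (ℝ × ℝ)) (A : ℝ × ℝ) (p : MvPolynomial (Fin 2) ℝ) : Prop :=
  p.totalDegree ≤ n ∧ ev p A = 1 ∧ ∀ B ∈ X, B ≠ A → ev p B = 0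

/-- `X` is a `GC_n` set: it is `n`-poised and each fundamental polynomial is a product of
`n` linear (degree-1) polynomials. -/
def GCSet (n : ℕ) (X : Set (ℝ × ℝ)) : Prop :=
  Poised n X ∧ ∀ A ∈ X, ∃ p : MvPolynomial (Fin 2) ℝ, IsFund n X A p ∧
    ∃ f : Fin n → MvPolynomial (Fin 2) ℝ, (∀ i, IsLinePoly (f i)) ∧ p = ∏ i, f i

/-- The node `A` uses the line `l`: the linear polynomial `l` divides a fundamental
polynomial of `A`. -/
def Uses (n : ℕ) (X : Set (ℝ × ℝ)) (A : ℝ × ℝ) (l : MvPolynomial (Fin 2) ℝ) : Prop :=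
  ∃ p, IsFund n X A p ∧ l ∣ p

/-- `X` has no maximal line, i.e. no line passes through `n+1` nodes of `X`. -/
def NoMaximalLine (n : ℕ) (X : Set (ℝ × ℝ)) : Prop :=
  ∀ l : MvPolynomial (Fin 2) ℝ, IsLinePoly l → nodesOn X l ≠ n + 1

lemma IsLinePoly.exists_coeffs {l : MvPolynomial (Fin 2) ℝ} (hl : IsLinePoly l) :
    ∃ a b c : ℝ, a ^ 2 + b ^ 2 ≠ 0 ∧ l = C a * X 0 + C b * X 1 + C c := by
  have key : l = C (l.coeff (Finsupp.single 0 1)) * X 0 + C (l.coeff (Finsupp.single 1 1)) * X 1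
      + C (l.coeff 0) := by
    ext m
    simp only [coeff_add, coeff_C_mul, coeff_X, coeff_C]
    by_cases h0 : 0 = m
    · subst h0; simp
    by_cases h1 : Finsupp.single 0 1 = m
    · subst h1; simp [Finsupp.single_left_inj, h0]
    by_cases h2 : Finsupp.single 1 1 = m
    · subst h2; simp [Finsupp.single_left_inj, h0]
    simp only [h0, h1, h2, if_false, mul_zero, add_zero]
    apply coeff_eq_zero_of_totalDegree_lt
    rw [hl]
    by_contra hlt
    have hdeg : m.degree ≤ 1 := not_lt.mp hlt
    rw [Finsupp.degree_eq_sum, Fin.sum_univ_two] at hdeg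
    have hcases : (m 0 = 0 ∧ m 1 = 0) ∨ (m 0 = 1 ∧ m 1 = 0) ∨ (m 0 = 0 ∧ m 1 = 1) := by omega
    rcases hcases with ⟨e0, e1⟩ | ⟨e0, e1⟩ | ⟨e0, e1⟩
    · exact h0 (by ext i; fin_cases i <;> simp [e0, e1])
    · exact h1 (by ext i; fin_cases i <;> simp [e0, e1])
    · exact h2 (by ext i; fin_cases i <;> simp [e0, e1])
  refine ⟨_, _, _, fun h => ?_, key⟩
  have ha : l.coeff (Finsupp.single 0 1) = 0 := by
    nlinarith [sq_nonneg (l.coeff (Finsupp.single 1 1)),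
      sq_nonneg (l.coeff (Finsupp.single 0 1))]
  have hb : l.coeff (Finsupp.single 1 1) = 0 := by
    nlinarith [sq_nonneg (l.coeff (Finsupp.single 1 1)),
      sq_nonneg (l.coeff (Finsupp.single 0 1))]
  rw [ha, hb] at key
  have : l.totalDegree = 1 := hl
  rw [key] at this
  simp at this

lemma IsLinePoly.infinite_lineSet {l : MvPolynomial (Fin 2) ℝ} (hl : IsLinePoly l) :
    (lineSet l).Infinite := by
  obtain ⟨a, b, c, hs, rfl⟩ := hl.exists_coeffs
  refine Set.infinite_of_injective_forall_mem (α := ℝ)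
    (f := fun t => (-a * c / (a ^ 2 + b ^ 2) - b * t, -b * c / (a ^ 2 + b ^ 2) + a * t)) ?_ ?_
  · intro t u h
    simp only [Prod.mk.injEq] at h
    apply mul_left_cancel₀ hs
    linear_combination a * h.2 - b * h.1
  · intro t
    simp only [lineSet, ev, Set.mem_ofPred_eq, map_add, map_mul, eval_C, eval_X]
    simp
    field_simp
    ring

/-- A polynomial of degree at most `d` vanishing at more than `d` points of a line is divisible
by the polynomial of that line. -/
lemma IsLinePoly.dvd_of_card_lt {l p : MvPolynomial (Fin 2) ℝ} (hl : IsLinePoly l) {d : ℕ}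
    (hp : p.totalDegree ≤ d) (S : Finset (ℝ × ℝ)) (hS : d < S.card)
    (hSl : ∀ P ∈ S, ev l P = 0) (hSp : ∀ P ∈ S, ev p P = 0) : l ∣ p := by
  obtain ⟨a, b, c, hs, rfl⟩ := hl.exists_coeffs
  set s := a ^ 2 + b ^ 2 with hsdef
  let g : Fin 2 → Polynomial ℝ :=
    ![Polynomial.C (-a * c * s⁻¹) - Polynomial.C b * Polynomial.X,
      Polynomial.C (-b * c * s⁻¹) + Polynomial.C a * Polynomial.X]
  let φ : MvPolynomial (Fin 2) ℝ →ₐ[ℝ] Polynomial ℝ := aeval g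
  let ι : Polynomial ℝ →ₐ[ℝ] MvPolynomial (Fin 2) ℝ :=
    Polynomial.aeval (C s⁻¹ * (C a * X 1 - C b * X 0))
  let t : ℝ × ℝ → ℝ := fun P => (a * P.2 - b * P.1) * s⁻¹
  have hs1 : (C a ^ 2 + C b ^ 2) * C s⁻¹ = (1 : MvPolynomial (Fin 2) ℝ) := by
    rw [← C_pow, ← C_pow, ← C_add, ← C_mul, ← hsdef, mul_inv_cancel₀ hs, C_1]
  have hφeval : ∀ P : ℝ × ℝ, ev (C a * X 0 + C b * X 1 + C c) P = 0 →
      ∀ q, (φ q).eval (t P) = ev q P := by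
    intro P hP q
    have hlin : a * P.1 + b * P.2 + c = 0 := by simpa [ev] using hP
    have hcomp : (Polynomial.aeval (t P)).comp φ = aeval ![P.1, P.2] := by
      apply algHom_ext
      intro i
      fin_cases i
      · simp [φ, g, t]
        field_simp
        linear_combination P.1 * hsdef - a * hlin
      · simp [φ, g, t]
        field_simp
        linear_combination P.2 * hsdef - b * hlin
    exact DFunLike.congr_fun hcomp q
  have hφ : φ p = 0 := by
    refine Polynomial.eq_zero_of_natDegree_lt_card_of_eval_eq_zero' _ (S.image t) ?_ ?_
    · intro x hx
      obtain ⟨P, hP, rfl⟩ := Finset.mem_image.mp hx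
      rw [hφeval P (hSl P hP), hSp P hP]
    · rw [Finset.card_image_of_injOn]
      · refine lt_of_le_of_lt ?_ hS
        have := aeval_natDegree_le (n := 1) p hp g (by
          intro i
          fin_cases i <;> simp [g] <;> compute_degree)
        simpa using this
      · intro P hP Q hQ h
        have e0 := hφeval P (hSl P hP)
        have e1 := hφeval Q (hSl Q hQ)
        rw [← h] at e1
        have f0 := (e0 (X 0)).symm.trans (e1 (X 0))
        have f1 := (e0 (X 1)).symm.trans (e1 (X 1))
        exact Prod.ext (by simpa [ev] using f0) (by simpa [ev] using f1)
  let I := Ideal.span {(C a * X 0 + C b * X 1 + C c : MvPolynomial (Fin 2) ℝ)}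
  have hcomp : (Ideal.Quotient.mkₐ ℝ I).comp (ι.comp φ) = Ideal.Quotient.mkₐ ℝ I := by
    apply algHom_ext
    intro i
    change Ideal.Quotient.mk I _ = Ideal.Quotient.mk I _
    rw [Ideal.Quotient.mk_eq_mk_iff_sub_mem, Ideal.mem_span_singleton]
    fin_cases i
    · refine ⟨-(C a * C s⁻¹), ?_⟩
      simp [φ, ι, g, MvPolynomial.algebraMap_eq]
      linear_combination X 0 * hs1
    · refine ⟨-(C b * C s⁻¹), ?_⟩
      simp [φ, ι, g, MvPolynomial.algebraMap_eq]
      linear_combination X 1 * hs1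
  have := DFunLike.congr_fun hcomp p
  simp only [AlgHom.comp_apply, hφ, map_zero] at this
  exact Ideal.mem_span_singleton.mp (Ideal.Quotient.eq_zero_iff_mem.mp this.symm)

lemma IsLinePoly.ne_zero {l : MvPolynomial (Fin 2) ℝ} (hl : IsLinePoly l) : l ≠ 0 := by
  rintro rfl
  simp [IsLinePoly] at hl

lemma ev_mul (p q : MvPolynomial (Fin 2) ℝ) (P : ℝ × ℝ) : ev (p * q) P = ev p P * ev q P :=
  map_mul _ p q

lemma ev_eq_zero_of_dvd {p q : MvPolynomial (Fin 2) ℝ} (h : p ∣ q) {P : ℝ × ℝ}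
    (hp : ev p P = 0) : ev q P = 0 := by
  obtain ⟨r, rfl⟩ := h
  rw [ev_mul, hp, zero_mul]

/-- The points of `S` lying on the curve `l = 0`. -/
noncomputable def ptsOn (S : Finset (ℝ × ℝ)) (l : MvPolynomial (Fin 2) ℝ) : Finset (ℝ × ℝ) := by
  classical exact S.filter fun P => ev l P = 0

/-- The points of `S` lying off the curve `l = 0`. -/
noncomputable def ptsOff (S : Finset (ℝ × ℝ)) (l : MvPolynomial (Fin 2) ℝ) : Finset (ℝ × ℝ) := by
  classical exact S.filter fun P => ¬ ev l P = 0

lemma mem_ptsOn {S : Finset (ℝ × ℝ)} {l : MvPolynomial (Fin 2) ℝ} {P : ℝ × ℝ} :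
    P ∈ ptsOn S l ↔ P ∈ S ∧ ev l P = 0 := by
  simp [ptsOn]

lemma mem_ptsOff {S : Finset (ℝ × ℝ)} {l : MvPolynomial (Fin 2) ℝ} {P : ℝ × ℝ} :
    P ∈ ptsOff S l ↔ P ∈ S ∧ ev l P ≠ 0 := by
  simp [ptsOff]

lemma card_ptsOn_add_card_ptsOff (S : Finset (ℝ × ℝ)) (l : MvPolynomial (Fin 2) ℝ) :
    (ptsOn S l).card + (ptsOff S l).card = S.card := by
  classical
  simpa [ptsOn, ptsOff] using S.card_filter_add_card_filter_not fun P => ev l P = 0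

lemma ptsOn_mono {S T : Finset (ℝ × ℝ)} (h : S ⊆ T) (l : MvPolynomial (Fin 2) ℝ) :
    ptsOn S l ⊆ ptsOn T l := fun _ hP =>
  mem_ptsOn.mpr ⟨h (mem_ptsOn.mp hP).1, (mem_ptsOn.mp hP).2⟩

lemma ptsOff_subset (S : Finset (ℝ × ℝ)) (l : MvPolynomial (Fin 2) ℝ) : ptsOff S l ⊆ S :=
  fun _ hP => (mem_ptsOff.mp hP).1

/-- The polynomials of degree at most `d` vanishing on `S`. -/
def vanishingPolys (d : ℕ) (S : Finset (ℝ × ℝ)) : Submodule ℝ (MvPolynomial (Fin 2) ℝ) where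
  carrier := {q | q.totalDegree ≤ d ∧ ∀ P ∈ S, ev q P = 0}
  zero_mem' := by simp [ev]
  add_mem' {p q} hp hq := by
    refine ⟨(totalDegree_add p q).trans (max_le hp.1 hq.1), fun P hP => ?_⟩
    have := hp.2 P hP
    have := hq.2 P hP
    simp_all [ev]
  smul_mem' c p hp := by
    refine ⟨(totalDegree_smul_le c p).trans hp.1, fun P hP => ?_⟩
    have := hp.2 P hP
    simp_all [ev]

lemma mem_vanishingPolys {d : ℕ} {S : Finset (ℝ × ℝ)} {q : MvPolynomial (Fin 2) ℝ} :
    q ∈ vanishingPolys d S ↔ q.totalDegree ≤ d ∧ ∀ P ∈ S, ev q P = 0 := Iff.rfl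

lemma IsLinePoly.exists_mem_vanishingPolys_of_dvd {l q : MvPolynomial (Fin 2) ℝ}
    (hl : IsLinePoly l) {d : ℕ} {S : Finset (ℝ × ℝ)} (hq : q ∈ vanishingPolys (d + 1) S)
    (h : l ∣ q) : ∃ r ∈ vanishingPolys d (ptsOff S l), q = l * r := by
  obtain ⟨r, rfl⟩ := h
  refine ⟨r, ⟨?_, fun P hP => ?_⟩, rfl⟩
  · by_cases hr : r = 0
    · simp [hr]
    have := hq.1
    rw [totalDegree_mul_of_isDomain hl.ne_zero hr, hl] at this
    omega
  · obtain ⟨hPS, hPl⟩ := mem_ptsOff.mp hP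
    have := hq.2 P hPS
    rw [ev_mul] at this
    exact (mul_eq_zero.mp this).resolve_left hPl

lemma IsLinePoly.dvd_of_lt_card_ptsOn {l q : MvPolynomial (Fin 2) ℝ}
    (hl : IsLinePoly l) {d : ℕ} {S : Finset (ℝ × ℝ)} (hq : q ∈ vanishingPolys d S)
    (h : d < (ptsOn S l).card) : l ∣ q :=
  hl.dvd_of_card_lt hq.1 _ h (fun _ hP => (mem_ptsOn.mp hP).2)
    fun P hP => hq.2 P (mem_ptsOn.mp hP).1

lemma rank_vanishingPolys_zero_le (S : Finset (ℝ × ℝ)) :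
    Module.rank ℝ (vanishingPolys 0 S) ≤ 1 := by
  have hle : vanishingPolys 0 S ≤ Submodule.span ℝ {1} := by
    intro q hq
    rw [Submodule.mem_span_singleton]
    refine ⟨q.coeff 0, ?_⟩
    rw [smul_eq_C_mul, mul_one]
    exact (totalDegree_eq_zero_iff_eq_C.mp (Nat.le_zero.mp hq.1)).symm
  exact (Submodule.rank_mono hle).trans ((rank_span_le _).trans (by simp))

lemma IsLinePoly.rank_vanishingPolys_succ_le {l : MvPolynomial (Fin 2) ℝ} (hl : IsLinePoly l)
    (d : ℕ) (S : Finset (ℝ × ℝ)) :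
    Module.rank ℝ (vanishingPolys (d + 1) S) ≤
      (d + 2 - (ptsOn S l).card : ℕ) + Module.rank ℝ (vanishingPolys d (ptsOff S l)) := by
  classical
  obtain ⟨T, hT, hTcard⟩ := (hl.infinite_lineSet.sdiff S.finite_toSet).exists_subset_card_eq
    (d + 2 - (ptsOn S l).card)
  let f : vanishingPolys (d + 1) S →ₗ[ℝ] (T → ℝ) :=
    { toFun := fun q P => ev q.1 P.1
      map_add' := fun p q => by ext P; simp [ev]
      map_smul' := fun c p => by ext P; simp [ev] }
  have hrange : Module.rank ℝ (LinearMap.range f) ≤ (d + 2 - (ptsOn S l).card : ℕ) := by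
    refine (Submodule.rank_le _).trans ?_
    rw [rank_fun', Fintype.card_coe, hTcard]
  have hker : Module.rank ℝ (LinearMap.ker f) ≤ Module.rank ℝ (vanishingPolys d (ptsOff S l)) := by
    have hle : (LinearMap.ker f).map (vanishingPolys (d + 1) S).subtype ≤
        (vanishingPolys d (ptsOff S l)).map (LinearMap.mulLeft ℝ l) := by
      rintro _ ⟨q, hq, rfl⟩
      have hqT : ∀ P ∈ T, ev q.1 P = 0 := fun P hP =>
        congrFun (LinearMap.mem_ker.mp hq) ⟨P, hP⟩
      have hdvd : l ∣ q.1 := by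
        refine hl.dvd_of_card_lt q.2.1 (ptsOn S l ∪ T) ?_ ?_ ?_
        · rw [Finset.card_union_of_disjoint, hTcard]
          · omega
          · exact Finset.disjoint_left.mpr fun P hP hPT => (hT hPT).2 (mem_ptsOn.mp hP).1
        · intro P hP
          rcases Finset.mem_union.mp hP with h | h
          exacts [(mem_ptsOn.mp h).2, (hT h).1]
        · intro P hP
          rcases Finset.mem_union.mp hP with h | h
          exacts [q.2.2 P (mem_ptsOn.mp h).1, hqT P h]
      obtain ⟨r, hr, hqr⟩ := hl.exists_mem_vanishingPolys_of_dvd q.2 hdvd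
      exact ⟨r, hr, hqr.symm⟩
    rw [(Submodule.equivMapOfInjective _ (Submodule.injective_subtype _) _).rank_eq]
    exact (Submodule.rank_mono hle).trans (rank_map_le _ _)
  rw [← LinearMap.rank_range_add_rank_ker f]
  exact add_le_add hrange hker

/-- Among finitely many lines covering `S`, one with the most points of `S` can be split off. -/
lemma exists_max_ptsOn {ι : Type*} [DecidableEq ι] (a : ι → MvPolynomial (Fin 2) ℝ) (I : Finset ι)
    (hI : I.Nonempty) (S : Finset (ℝ × ℝ)) (hS : ∀ P ∈ S, ∃ i ∈ I, ev (a i) P = 0) :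
    ∃ i ∈ I, (∀ P ∈ ptsOff S (a i), ∃ j ∈ I.erase i, ev (a j) P = 0) ∧
      ∀ j, j ∈ I.erase i → (ptsOn (ptsOff S (a i)) (a j)).card ≤ (ptsOn S (a i)).card := by
  obtain ⟨i, hi, hmax⟩ := I.exists_max_image (fun i => (ptsOn S (a i)).card) hI
  refine ⟨i, hi, fun P hP => ?_, fun j hj => ?_⟩
  · obtain ⟨hPS, hPi⟩ := mem_ptsOff.mp hP
    obtain ⟨j, hj, hPj⟩ := hS P hPS
    refine ⟨j, Finset.mem_erase.mpr ⟨?_, hj⟩, hPj⟩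
    rintro rfl
    exact hPi hPj
  · exact (Finset.card_le_card (ptsOn_mono (ptsOff_subset _ _) _)).trans
      (hmax j (Finset.mem_of_mem_erase hj))

/-- Four lines covering `S` can be ordered so that the numbers of new points are nonincreasing. -/
lemma exists_greedy_order {ι : Type*} [DecidableEq ι] (a : ι → MvPolynomial (Fin 2) ℝ)
    (I : Finset ι) (hI : I.card = 4) (S : Finset (ℝ × ℝ))
    (hS : ∀ P ∈ S, ∃ i ∈ I, ev (a i) P = 0) :
    ∃ i j k m,
      (ptsOn (ptsOff S (a i)) (a j)).card ≤ (ptsOn S (a i)).card ∧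
      (ptsOn (ptsOff (ptsOff S (a i)) (a j)) (a k)).card ≤ (ptsOn (ptsOff S (a i)) (a j)).card ∧
      (ptsOn (ptsOff (ptsOff (ptsOff S (a i)) (a j)) (a k)) (a m)).card ≤
        (ptsOn (ptsOff (ptsOff S (a i)) (a j)) (a k)).card ∧
      ptsOff (ptsOff (ptsOff (ptsOff S (a i)) (a j)) (a k)) (a m) = ∅ := by
  obtain ⟨i, hi, hS1, h1⟩ := exists_max_ptsOn a I (Finset.card_pos.mp (by omega)) S hS
  have c1 := Finset.card_erase_of_mem hi
  obtain ⟨j, hj, hS2, h2⟩ := exists_max_ptsOn a _ (Finset.card_pos.mp (by omega)) _ hS1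
  have c2 := Finset.card_erase_of_mem hj
  obtain ⟨k, hk, hS3, h3⟩ := exists_max_ptsOn a _ (Finset.card_pos.mp (by omega)) _ hS2
  have c3 := Finset.card_erase_of_mem hk
  obtain ⟨m, hm, hS4, -⟩ := exists_max_ptsOn a _ (Finset.card_pos.mp (by omega)) _ hS3
  have c4 := Finset.card_erase_of_mem hm
  refine ⟨i, j, k, m, h1 j hj, h2 k hk, h3 m hm, Finset.eq_empty_of_forall_notMem fun P hP => ?_⟩
  obtain ⟨n, hn, -⟩ := hS4 P hP
  have := Finset.card_pos.mpr ⟨n, hn⟩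
  omega

lemma IsFund.unique {n : ℕ} {X : Set (ℝ × ℝ)} (hX : Poised n X) {A : ℝ × ℝ}
    {p q : MvPolynomial (Fin 2) ℝ} (hp : IsFund n X A p) (hq : IsFund n X A q) : p = q := by
  refine sub_eq_zero.mp (hX.2.2 _ ((totalDegree_sub p q).trans (max_le hp.1 hq.1)) fun B hB => ?_)
  have hsub : ev (p - q) B = ev p B - ev q B := map_sub _ p q
  by_cases hBA : B = A
  · rw [hsub, hBA, hp.2.1, hq.2.1, sub_self]
  · rw [hsub, hp.2.2 B hB hBA, hq.2.2 B hB hBA, sub_self]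

lemma Uses.ev_ne_zero {n : ℕ} {X : Set (ℝ × ℝ)} {A : ℝ × ℝ} {l : MvPolynomial (Fin 2) ℝ}
    (h : Uses n X A l) : ev l A ≠ 0 := by
  obtain ⟨p, hp, hlp⟩ := h
  intro h0
  exact one_ne_zero (hp.2.1.symm.trans (ev_eq_zero_of_dvd hlp h0))

lemma nodesOn_eq_card {X : Set (ℝ × ℝ)} (hX : X.Finite) (l : MvPolynomial (Fin 2) ℝ) :
    nodesOn X l = (ptsOn hX.toFinset l).card := by
  rw [nodesOn, ← Set.ncard_coe_finset]
  congr 1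
  ext P
  simp [mem_ptsOn, lineSet]

/-- The fundamental polynomial of a node using `l` is `l` times a polynomial of degree at most
`n` vanishing at all the other nodes off `l`. -/
lemma Uses.exists_cofactor {n : ℕ} {X : Set (ℝ × ℝ)} {A : ℝ × ℝ} {l : MvPolynomial (Fin 2) ℝ}
    (h : Uses (n + 1) X A l) (hl : IsLinePoly l) :
    ∃ q : MvPolynomial (Fin 2) ℝ, IsFund (n + 1) X A (l * q) ∧ q.totalDegree ≤ n ∧ ev q A ≠ 0 ∧
      ∀ B ∈ X, B ≠ A → ev l B ≠ 0 → ev q B = 0 := by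
  obtain ⟨_, hp, q, rfl⟩ := h
  have hqA : ev q A ≠ 0 := by
    intro h0
    have := hp.2.1
    rw [ev_mul, h0, mul_zero] at this
    exact zero_ne_one this
  refine ⟨q, hp, ?_, hqA, fun B hB hBA hBl => ?_⟩
  · have hq : q ≠ 0 := by
      rintro rfl
      simp [ev] at hqA
    have := hp.1
    rw [totalDegree_mul_of_isDomain hl.ne_zero hq, hl] at this
    omega
  · have := hp.2.2 B hB hBA
    rw [ev_mul] at this
    exact (mul_eq_zero.mp this).resolve_left hBl

lemma card_ptsOn_le_of_noMaximalLine {n : ℕ} {X : Set (ℝ × ℝ)} (hX : GCSet n X)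
    (hnm : NoMaximalLine n X) {l : MvPolynomial (Fin 2) ℝ} (hl : IsLinePoly l) :
    (ptsOn hX.1.1.toFinset l).card ≤ n := by
  classical
  by_contra! hcard
  have hne := hnm l hl
  rw [nodesOn_eq_card hX.1.1] at hne
  obtain ⟨A, hA⟩ : (ptsOn hX.1.1.toFinset l).Nonempty := Finset.card_pos.mp (by omega)
  have hmem : ∀ P ∈ ptsOn hX.1.1.toFinset l, P ∈ X := fun P hP => by
    simpa using (mem_ptsOn.mp hP).1
  obtain ⟨p, hp, -⟩ := hX.2 A (hmem A hA)
  have hdvd : l ∣ p := by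
    refine hl.dvd_of_card_lt hp.1 ((ptsOn hX.1.1.toFinset l).erase A) ?_ ?_ ?_
    · rw [Finset.card_erase_of_mem hA]
      omega
    · exact fun P hP => (mem_ptsOn.mp (Finset.mem_of_mem_erase hP)).2
    · exact fun P hP => hp.2.2 P (hmem P (Finset.mem_of_mem_erase hP)) (Finset.ne_of_mem_erase hP)
  exact Uses.ev_ne_zero ⟨p, hp, hdvd⟩ (mem_ptsOn.mp hA).2

lemma IsLinePoly.prime {l : MvPolynomial (Fin 2) ℝ} (hl : IsLinePoly l) : Prime l := by
  refine (irreducible_of_totalDegree_eq_one hl fun x hx => ?_).prime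
  rw [isUnit_iff_ne_zero]
  rintro rfl
  exact hl.ne_zero (by ext m; simpa using hx m)

/-- If a node `A` of a `GC_{n+1}` set uses `l`, then the other nodes off `l` are covered by `n`
lines. -/
lemma Uses.exists_cover {n : ℕ} {X : Set (ℝ × ℝ)} (hX : GCSet (n + 1) X) {A : ℝ × ℝ} (hA : A ∈ X)
    {l : MvPolynomial (Fin 2) ℝ} (hl : IsLinePoly l) (h : Uses (n + 1) X A l) :
    ∃ (a : Fin (n + 1) → MvPolynomial (Fin 2) ℝ) (I : Finset (Fin (n + 1))), I.card = n ∧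
      (∀ i, IsLinePoly (a i)) ∧
      ∀ B ∈ X, B ≠ A → ev l B ≠ 0 → ∃ i ∈ I, ev (a i) B = 0 := by
  obtain ⟨p, hp, hlp⟩ := h
  obtain ⟨_, hp', a, ha, rfl⟩ := hX.2 A hA
  obtain rfl := hp.unique hX.1 hp'
  obtain ⟨i, -, r, hr⟩ := (hl.prime.dvd_finsetProd_iff _).mp hlp
  refine ⟨a, Finset.univ.erase i, by simp, ha, fun B hB hBA hBl => ?_⟩
  have h0 := hp.2.2 B hB hBA
  rw [ev, map_prod, Finset.prod_eq_zero_iff] at h0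
  obtain ⟨j, -, hj⟩ := h0
  refine ⟨j, Finset.mem_erase.mpr ⟨?_, Finset.mem_univ _⟩, hj⟩
  rintro rfl
  have hr0 : r.totalDegree = 0 := by
    have hr1 : r ≠ 0 := by
      rintro rfl
      exact (ha j).ne_zero (by simpa using hr)
    have := ha j
    rw [IsLinePoly, hr, totalDegree_mul_of_isDomain hl.ne_zero hr1, hl] at this
    omega
  rw [totalDegree_eq_zero_iff_eq_C] at hr0
  change ev (a j) B = 0 at hj
  rw [hr, ev_mul] at hj
  have hrB := (mul_eq_zero.mp hj).resolve_left hBl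
  rw [hr0] at hrB hr
  apply (ha j).ne_zero
  have : coeff 0 r = 0 := by simpa [ev] using hrB
  rw [hr, this, C_0, mul_zero]

/-- Nodes sharing `l` have independent cofactors. -/
lemma card_users_le_rank {n : ℕ} {X : Set (ℝ × ℝ)} (hX : X.Finite)
    {l : MvPolynomial (Fin 2) ℝ} (hl : IsLinePoly l) {U : Finset (ℝ × ℝ)} (hUX : ∀ P ∈ U, P ∈ X)
    (hU : ∀ P ∈ U, Uses (n + 1) X P l) :
    (U.card : Cardinal) ≤ Module.rank ℝ (vanishingPolys n (ptsOff hX.toFinset l \ U)) := by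
  classical
  choose q _ hq using fun P : U => (hU P.1 P.2).exists_cofactor hl
  let v : U → vanishingPolys n (ptsOff hX.toFinset l \ U) := fun P => ⟨q P, (hq P).1, by
    intro B hB
    obtain ⟨hB, hBU⟩ := Finset.mem_sdiff.mp hB
    obtain ⟨hBX, hBl⟩ := mem_ptsOff.mp hB
    refine (hq P).2.2 B (by simpa using hBX) ?_ hBl
    rintro rfl
    exact hBU P.2⟩
  have hv : LinearIndependent ℝ v := by
    rw [Fintype.linearIndependent_iff]
    intro g hg P
    have h0 : ∑ i, g i * ev (q i) P.1 = 0 := by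
      have := congrArg (fun w : vanishingPolys n (ptsOff hX.toFinset l \ U) => ev w.1 P.1) hg
      simpa [v, ev, smul_eq_C_mul] using this
    rw [Finset.sum_eq_single P] at h0
    · exact (mul_eq_zero.mp h0).resolve_right (hq P).2.1
    · intro i _ hi
      rw [(hq i).2.2 P.1 (hUX _ P.2) (fun h => hi (Subtype.ext h.symm)) (hU _ P.2).ev_ne_zero,
        mul_zero]
    · simp
  simpa using hv.cardinal_le_rank

/-- The nodes off `l`, except a nonempty set `U` of nodes using `l`, are covered by four lines
whose numbers of new nodes are nonincreasing and leave room for `U.card` independent quartics. -/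
lemma exists_greedy_cover {X : Set (ℝ × ℝ)} (hX : GCSet 5 X) (hnm : NoMaximalLine 5 X)
    {l : MvPolynomial (Fin 2) ℝ} (hl : IsLinePoly l) {U : Finset (ℝ × ℝ)} (hU0 : U.Nonempty)
    (hUX : ∀ P ∈ U, P ∈ X) (hU : ∀ P ∈ U, Uses 5 X P l) :
    ∃ (a b c : MvPolynomial (Fin 2) ℝ) (n : ℕ) (S : Finset (ℝ × ℝ)),
      IsLinePoly a ∧ IsLinePoly b ∧ IsLinePoly c ∧
      (∀ P, P ∈ S ↔ P ∈ X ∧ ev l P ≠ 0 ∧ P ∉ U) ∧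
      (ptsOn S a).card ≤ 5 ∧
      (ptsOn (ptsOff S a) b).card ≤ (ptsOn S a).card ∧
      (ptsOn (ptsOff (ptsOff S a) b) c).card ≤ (ptsOn (ptsOff S a) b).card ∧
      n ≤ (ptsOn (ptsOff (ptsOff S a) b) c).card ∧
      (ptsOn S a).card + (ptsOn (ptsOff S a) b).card + (ptsOn (ptsOff (ptsOff S a) b) c).card + n
        + U.card + nodesOn X l = 21 ∧
      U.card ≤ (5 - (ptsOn S a).card) + (4 - (ptsOn (ptsOff S a) b).card) +
        (3 - (ptsOn (ptsOff (ptsOff S a) b) c).card) + (2 - n) + 1 := by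
  classical
  obtain ⟨A, hA⟩ := hU0
  obtain ⟨a, I, hI, ha, hcov⟩ := (hU A hA).exists_cover hX (hUX A hA) hl
  have hmemS : ∀ P, P ∈ ptsOff hX.1.1.toFinset l \ U ↔ P ∈ X ∧ ev l P ≠ 0 ∧ P ∉ U := fun P => by
    simp [mem_ptsOff, and_assoc]
  have hScard : (ptsOff hX.1.1.toFinset l \ U).card + U.card + nodesOn X l = 21 := by
    have h1 := card_ptsOn_add_card_ptsOff hX.1.1.toFinset l
    have h0 := (Set.ncard_eq_toFinset_card X hX.1.1).symm.trans hX.1.2.1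
    have h2 := Finset.card_sdiff_add_card_eq_card (s := U) (t := ptsOff hX.1.1.toFinset l)
      fun P hP => mem_ptsOff.mpr ⟨by simpa using hUX P hP, (hU P hP).ev_ne_zero⟩
    rw [nodesOn_eq_card hX.1.1]
    omega
  have hrank := card_users_le_rank hX.1.1 hl hUX hU
  have hmono : ptsOff hX.1.1.toFinset l \ U ⊆ hX.1.1.toFinset :=
    Finset.sdiff_subset.trans (ptsOff_subset _ _)
  generalize ptsOff hX.1.1.toFinset l \ U = S at *
  obtain ⟨i, j, k, m, h1, h2, h3, h4⟩ := exists_greedy_order a I hI S fun P hP => by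
    obtain ⟨hPX, hPl, hPU⟩ := (hmemS P).mp hP
    exact hcov P hPX (fun h => hPU (h ▸ hA)) hPl
  refine ⟨a i, a j, a k, _, S, ha i, ha j, ha k, hmemS,
    (Finset.card_le_card (ptsOn_mono hmono _)).trans
      (card_ptsOn_le_of_noMaximalLine hX hnm (ha i)), h1, h2, h3, ?_, ?_⟩
  · have c1 := card_ptsOn_add_card_ptsOff S (a i)
    have c2 := card_ptsOn_add_card_ptsOff (ptsOff S (a i)) (a j)
    have c3 := card_ptsOn_add_card_ptsOff (ptsOff (ptsOff S (a i)) (a j)) (a k)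
    have c4 := card_ptsOn_add_card_ptsOff (ptsOff (ptsOff (ptsOff S (a i)) (a j)) (a k)) (a m)
    rw [h4, Finset.card_empty] at c4
    omega
  · have r1 := (ha i).rank_vanishingPolys_succ_le 3 S
    have r2 := (ha j).rank_vanishingPolys_succ_le 2 (ptsOff S (a i))
    have r3 := (ha k).rank_vanishingPolys_succ_le 1 (ptsOff (ptsOff S (a i)) (a j))
    have r4 := (ha m).rank_vanishingPolys_succ_le 0 (ptsOff (ptsOff (ptsOff S (a i)) (a j)) (a k))
    have r5 := rank_vanishingPolys_zero_le
      (ptsOff (ptsOff (ptsOff (ptsOff S (a i)) (a j)) (a k)) (a m))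
    have := hrank.trans <| r1.trans <| add_le_add_right (r2.trans <| add_le_add_right
      (r3.trans <| add_le_add_right (r4.trans <| add_le_add_right r5 _) _) _) _
    norm_cast at this
    omega

/-- in a `GC_5` set with no maximal line, a line used by three distinct nodes
`A, B, C` passes through at least three nodes of `X`; if moreover it is a 4-node line, then
`A, B, C` share it and three other lines, and it is used by exactly `A, B, C`. -/
theorem line_used_three_times (X : Set (ℝ × ℝ)) (hX : GCSet 5 X) (hnm : NoMaximalLine 5 X)
    (l : MvPolynomial (Fin 2) ℝ) (hl : IsLinePoly l) (A B C : ℝ × ℝ)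
    (hA : A ∈ X) (hB : B ∈ X) (hC : C ∈ X) (hAB : A ≠ B) (hAC : A ≠ C) (hBC : B ≠ C)
    (hAu : Uses 5 X A l) (hBu : Uses 5 X B l) (hCu : Uses 5 X C l) :
    3 ≤ nodesOn X l ∧
    (nodesOn X l = 4 →
      (∃ m1 m2 m3 : MvPolynomial (Fin 2) ℝ,
        IsLinePoly m1 ∧ IsLinePoly m2 ∧ IsLinePoly m3 ∧
        lineSet m1 ≠ lineSet m2 ∧ lineSet m1 ≠ lineSet m3 ∧ lineSet m2 ≠ lineSet m3 ∧
        lineSet m1 ≠ lineSet l ∧ lineSet m2 ≠ lineSet l ∧ lineSet m3 ≠ lineSet l ∧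
        ∀ P ∈ ({A, B, C} : Set (ℝ × ℝ)),
          Uses 5 X P m1 ∧ Uses 5 X P m2 ∧ Uses 5 X P m3) ∧
      {D | D ∈ X ∧ Uses 5 X D l} = {A, B, C}) := by
  classical
  have hmem3 : ∀ P ∈ ({A, B, C} : Finset (ℝ × ℝ)), P ∈ X ∧ Uses 5 X P l := by
    simp [hA, hB, hC, hAu, hBu, hCu]
  have hcard3 : ({A, B, C} : Finset (ℝ × ℝ)).card = 3 := Finset.card_eq_three.mpr
    ⟨A, B, C, hAB, hAC, hBC, rfl⟩
  obtain ⟨a, b, c, n, S, ha, hb, hc, hS, h1, h2, h3, h4, hsum, hle⟩ :=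
    exists_greedy_cover hX hnm hl (U := {A, B, C}) (by simp)
      (fun P hP => (hmem3 P hP).1) (fun P hP => (hmem3 P hP).2)
  rw [hcard3] at hsum hle
  refine ⟨by omega, fun h => ⟨⟨a, b, c, ha, hb, hc, ?_⟩, ?_⟩⟩
  · have hSl : ∀ P ∈ S, ev l P ≠ 0 := fun P hP => ((hS P).mp hP).2.1
    obtain ⟨P, hP⟩ : (ptsOn S a).Nonempty := Finset.card_pos.mp (by omega)
    obtain ⟨Q, hQ⟩ : (ptsOn (ptsOff S a) b).Nonempty := Finset.card_pos.mp (by omega)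
    obtain ⟨R, hR⟩ : (ptsOn (ptsOff (ptsOff S a) b) c).Nonempty := Finset.card_pos.mp (by omega)
    simp only [mem_ptsOn, mem_ptsOff] at hP hQ hR
    refine ⟨fun e => hQ.1.2 (e.symm.subset hQ.2), fun e => hR.1.1.2 (e.symm.subset hR.2),
      fun e => hR.1.2 (e.symm.subset hR.2), fun e => hSl P hP.1 (e.subset hP.2),
      fun e => hSl Q hQ.1.1 (e.subset hQ.2), fun e => hSl R hR.1.1.1 (e.subset hR.2),
      fun D hD => ?_⟩
    have hD' : D ∈ ({A, B, C} : Finset (ℝ × ℝ)) := by simpa using hD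
    obtain ⟨q, hfund, hqdeg, -, hq⟩ := (hmem3 D hD').2.exists_cofactor hl
    have hq4 : q ∈ vanishingPolys 4 S := ⟨hqdeg, fun B hB => by
      obtain ⟨hBX, hBl, hBU⟩ := (hS B).mp hB
      exact hq B hBX (fun e => hBU (e ▸ hD')) hBl⟩
    obtain ⟨r, hr, rfl⟩ := ha.exists_mem_vanishingPolys_of_dvd hq4
      (ha.dvd_of_lt_card_ptsOn hq4 (by omega))
    obtain ⟨s, hs, rfl⟩ := hb.exists_mem_vanishingPolys_of_dvd hr
      (hb.dvd_of_lt_card_ptsOn hr (by omega))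
    obtain ⟨t, rfl⟩ := hc.dvd_of_lt_card_ptsOn hs (by omega)
    exact ⟨⟨_, hfund, l * (b * (c * t)), by ring⟩, ⟨_, hfund, l * (a * (c * t)), by ring⟩,
      ⟨_, hfund, l * (a * (b * t)), by ring⟩⟩
  · ext D
    constructor
    · rintro ⟨hDX, hDu⟩
      by_contra hD
      have hD' : D ∉ ({A, B, C} : Finset (ℝ × ℝ)) := by simpa using hD
      have hmem4 : ∀ P ∈ insert D ({A, B, C} : Finset (ℝ × ℝ)), P ∈ X ∧ Uses 5 X P l := by
        intro P hP
        rcases Finset.mem_insert.mp hP with rfl | hP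
        exacts [⟨hDX, hDu⟩, hmem3 P hP]
      obtain ⟨a, b, c, n, S, -, -, -, -, h1, h2, h3, h4, hsum, hle⟩ :=
        exists_greedy_cover hX hnm hl (U := insert D {A, B, C}) (by simp)
          (fun P hP => (hmem4 P hP).1) (fun P hP => (hmem4 P hP).2)
      rw [Finset.card_insert_of_notMem hD', hcard3] at hsum hle
      omega
    · exact fun hD => hmem3 D (by simpa using hD)
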